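/- Fix a prior-evidence vector r ∈ ℝ^R and observations ω₁,ω₂,… ∈ ℝ, and define the uncertain likelihood ratio Λ(t) = P̂(ω₁,…,ω_t|φ_R)/P̂(ω₁,…,ω_t|φ₀) with Λ(0)=1. Then for every t ≥ 1, Λ(t) = ∏_{τ=1}^t ℓ(ω_τ), where the uncertain likelihood update ℓ(ω_{t+1}) = Λ(t+1)/Λ(t) admits the closed form ℓ(ω_{t+1}) = [Γ(α_{R+t+1})·Γ(α_t)·β_{t+1}^{α_{t+1}}·β_{R+t}^{α_{R+t}} / (Γ(α_{t+1})·Γ(α_{R+t})·β_t^{α_t}·β_{R+t+1}^{α_{R+t+1}})] · [(κ_{t+1}·κ_{R+t})/(κ_t·κ_{R+t+1})]^{1/2}, where (μ_{R+t},κ_{R+t},α_{R+t},β_{R+t}) denotes φ₀ updated with the combined data (r₁,…,r_R,ω₁,…,ω_t) and (μ_t,κ_t,α_t,β_t) denotes φ₀ updated with (ω₁,…,ω_t). (Eqs. (3) and (13).) -/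

import Mathlib

open MeasureTheory ProbabilityTheory Real Filter Finset

noncomputable section

/-- Gaussian density `N(ω|μ,λ⁻¹)` with mean `μ` and precision `lam`. -/
def gaussPDF (μ lam ω : ℝ) : ℝ :=
  Real.sqrt (lam / (2 * Real.pi)) * Real.exp (-(lam * (ω - μ) ^ 2) / 2)

/-- Joint Gaussian density of a vector of observations. -/
def gaussVecPDF {n : ℕ} (μ lam : ℝ) (x : Fin n → ℝ) : ℝ :=
  ∏ k, gaussPDF μ lam (x k)

/-- Parameters of a Gaussian-gamma distribution. -/
structure GG where
  μ : ℝ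
  κ : ℝ
  α : ℝ
  β : ℝ

/-- Gaussian-gamma density `NG(x, lam | φ)`. -/
def ngPDF (φ : GG) (x lam : ℝ) : ℝ :=
  (φ.β ^ φ.α * Real.sqrt φ.κ / (Real.Gamma φ.α * Real.sqrt (2 * Real.pi))) *
    lam ^ (φ.α - 1 / 2) * Real.exp (-φ.β * lam) *
    Real.exp (-(φ.κ * lam * (x - φ.μ) ^ 2) / 2)

/-- Sample mean. -/
def sampleMean {n : ℕ} (x : Fin n → ℝ) : ℝ := (∑ k, x k) / n

/-- Gaussian-gamma parameter update with data `x`. -/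
def updateGG (φ : GG) {n : ℕ} (x : Fin n → ℝ) : GG where
  μ := (φ.κ * φ.μ + n * sampleMean x) / (φ.κ + n)
  κ := φ.κ + n
  α := φ.α + n / 2
  β := φ.β + (∑ k, (x k - sampleMean x) ^ 2) / 2 +
        φ.κ * n * (sampleMean x - φ.μ) ^ 2 / (2 * (φ.κ + n))

/-- The noninformative prior `φ₀ = (0,1,1,1)`. -/
def phi0 : GG := ⟨0, 1, 1, 1⟩

/-- Posterior predictive probability `P̂(x | φ)`. -/
def postPred (φ : GG) {n : ℕ} (x : Fin n → ℝ) : ℝ :=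
  ∫ lam in Set.Ioi (0 : ℝ), (∫ m : ℝ, gaussVecPDF m lam x * ngPDF φ m lam)

/-- One-step posterior predictive density `P̂(x | w₁,…,w_n)` under the noninformative prior. -/
def osPred {n : ℕ} (w : Fin n → ℝ) (x : ℝ) : ℝ :=
  postPred phi0 (Fin.snoc w x) / postPred phi0 w

/-- Kullback–Leibler divergence between densities on `ℝ`. -/
def klDivR (p q : ℝ → ℝ) : ℝ := ∫ x : ℝ, p x * Real.log (p x / q x)


/-- Parameters after updating φ₀ with the observations only. -/
def phiT (w : ℕ → ℝ) (t : ℕ) : GG := updateGG phi0 (fun k : Fin t => w k)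

/-- Parameters after updating φ₀ with the prior evidence and the observations. -/
def phiRT {R : ℕ} (r : Fin R → ℝ) (w : ℕ → ℝ) (t : ℕ) : GG :=
  updateGG phi0 (Fin.append r (fun k : Fin t => w k))

lemma gaussVecPDF_eq {n : ℕ} (μ lam : ℝ) (x : Fin n → ℝ) :
    gaussVecPDF μ lam x =
      Real.sqrt (lam / (2 * π)) ^ n * Real.exp (-(lam * ∑ k, (x k - μ) ^ 2) / 2) := by
  simp only [gaussVecPDF, gaussPDF, Finset.prod_mul_distrib, ← Real.exp_sum, Finset.prod_const,
    Finset.card_univ, Fintype.card_fin, Finset.mul_sum, ← Finset.sum_div, Finset.sum_neg_distrib]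

lemma natCast_mul_sampleMean {n : ℕ} (x : Fin n → ℝ) : n * sampleMean x = ∑ k, x k := by
  rcases Nat.eq_zero_or_pos n with rfl | hn
  · simp
  · have : (n : ℝ) ≠ 0 := by positivity
    rw [sampleMean]
    field_simp

lemma sum_sub_sq {n : ℕ} (x : Fin n → ℝ) (c : ℝ) :
    ∑ k, (x k - c) ^ 2 = ∑ k, x k ^ 2 - 2 * c * ∑ k, x k + n * c ^ 2 := by
  simp only [sub_sq, Finset.sum_add_distrib, Finset.sum_sub_distrib, Finset.mul_sum,
    Finset.sum_const, Finset.card_univ, Fintype.card_fin, nsmul_eq_mul]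
  congr 2
  exact Finset.sum_congr rfl fun k _ => by ring

lemma updateGG_μ {n : ℕ} (φ : GG) (x : Fin n → ℝ) :
    (updateGG φ x).μ = (φ.κ * φ.μ + ∑ k, x k) / (φ.κ + n) := by
  simp only [updateGG, natCast_mul_sampleMean]

lemma updateGG_β {n : ℕ} (φ : GG) (hκ : 0 < φ.κ) (x : Fin n → ℝ) :
    (updateGG φ x).β = φ.β + (φ.κ * φ.μ ^ 2 + ∑ k, x k ^ 2
      - (φ.κ * φ.μ + ∑ k, x k) ^ 2 / (φ.κ + n)) / 2 := by
  have h : φ.κ + n ≠ 0 := by positivity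
  simp only [updateGG, sum_sub_sq]
  rw [← natCast_mul_sampleMean x]
  field_simp
  ring

/-- Updating sequentially agrees with updating on the combined data. -/
lemma updateGG_append {m n : ℕ} (φ : GG) (hκ : 0 < φ.κ) (x : Fin m → ℝ) (y : Fin n → ℝ) :
    updateGG φ (Fin.append x y) = updateGG (updateGG φ x) y := by
  have h₁ : φ.κ + m ≠ 0 := by positivity
  have h₂ : φ.κ + m + n ≠ 0 := by positivity
  have hκ' : (updateGG φ x).κ = φ.κ + m := rfl
  have hμ : (updateGG φ (Fin.append x y)).μ = (updateGG (updateGG φ x) y).μ := by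
    simp only [updateGG_μ, hκ', Fin.sum_univ_add, Fin.append_left, Fin.append_right, Nat.cast_add]
    field_simp
    ring
  have hβ : (updateGG φ (Fin.append x y)).β = (updateGG (updateGG φ x) y).β := by
    rw [updateGG_β φ hκ, updateGG_β (updateGG φ x) (by rw [hκ']; positivity), updateGG_β φ hκ]
    simp only [updateGG_μ, hκ', Fin.sum_univ_add, Fin.append_left, Fin.append_right, Nat.cast_add]
    field_simp
    ring
  have hκ'' : (updateGG φ (Fin.append x y)).κ = (updateGG (updateGG φ x) y).κ := by
    simp only [updateGG, Nat.cast_add]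
    ring
  have hα : (updateGG φ (Fin.append x y)).α = (updateGG (updateGG φ x) y).α := by
    simp only [updateGG, Nat.cast_add]
    ring
  exact GG.mk.injEq .. ▸ ⟨hμ, hκ'', hα, hβ⟩

lemma updateGG_of_isEmpty (φ : GG) (x : Fin 0 → ℝ) (hκ : φ.κ ≠ 0) : updateGG φ x = φ := by
  cases φ
  simp_all [updateGG]

/-- All scale parameters of a Gaussian-gamma distribution are positive. -/
structure GG.Pos (φ : GG) : Prop where
  κ : 0 < φ.κ
  α : 0 < φ.α
  β : 0 < φ.β

lemma phi0_pos : phi0.Pos := ⟨one_pos, one_pos, one_pos⟩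

lemma GG.Pos.updateGG {φ : GG} (h : φ.Pos) {n : ℕ} (x : Fin n → ℝ) : (updateGG φ x).Pos := by
  obtain ⟨hκ, hα, hβ⟩ := h
  exact ⟨by simp only [_root_.updateGG]; positivity, by simp only [_root_.updateGG]; positivity,
    by simp only [_root_.updateGG]; positivity⟩

/-- Completing the square in the mean. -/
lemma sum_sub_sq_add_eq_updateGG {n : ℕ} (φ : GG) (hκ : 0 < φ.κ) (x : Fin n → ℝ) (m : ℝ) :
    ∑ k, (x k - m) ^ 2 + φ.κ * (m - φ.μ) ^ 2 + 2 * φ.β =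
      (updateGG φ x).κ * (m - (updateGG φ x).μ) ^ 2 + 2 * (updateGG φ x).β := by
  have h : φ.κ + n ≠ 0 := by positivity
  rw [updateGG_β φ hκ, updateGG_μ, sum_sub_sq]
  simp only [updateGG]
  field_simp
  ring

lemma integral_exp_neg_mul_sub_sq (c a : ℝ) :
    ∫ m : ℝ, Real.exp (-c * (m - a) ^ 2) = Real.sqrt (π / c) := by
  rw [integral_sub_right_eq_self (fun m : ℝ => Real.exp (-c * m ^ 2)) a, integral_gaussian]

lemma integral_gaussVecPDF_mul_ngPDF {n : ℕ} {φ : GG} (h : φ.Pos) (x : Fin n → ℝ) {lam : ℝ}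
    (hlam : 0 < lam) :
    ∫ m : ℝ, gaussVecPDF m lam x * ngPDF φ m lam =
      φ.β ^ φ.α * Real.sqrt φ.κ / (Real.Gamma φ.α * Real.sqrt (updateGG φ x).κ
        * Real.sqrt (2 * π) ^ n) *
      (lam ^ ((updateGG φ x).α - 1) * Real.exp (-((updateGG φ x).β * lam))) := by
  have hκ := (h.updateGG x).κ
  have key : ∀ m : ℝ, gaussVecPDF m lam x * ngPDF φ m lam =
      (Real.sqrt (lam / (2 * π)) ^ n *
        (φ.β ^ φ.α * Real.sqrt φ.κ / (Real.Gamma φ.α * Real.sqrt (2 * π))) *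
        lam ^ (φ.α - 1 / 2) * Real.exp (-((updateGG φ x).β * lam))) *
      Real.exp (-((updateGG φ x).κ * lam / 2) * (m - (updateGG φ x).μ) ^ 2) := by
    intro m
    have hexp : Real.exp (-(lam * ∑ k, (x k - m) ^ 2) / 2) * Real.exp (-φ.β * lam) *
        Real.exp (-(φ.κ * lam * (m - φ.μ) ^ 2) / 2) =
        Real.exp (-((updateGG φ x).β * lam)) *
        Real.exp (-((updateGG φ x).κ * lam / 2) * (m - (updateGG φ x).μ) ^ 2) := by
      simp only [← Real.exp_add]
      congr 1
      linear_combination (-lam / 2) * sum_sub_sq_add_eq_updateGG φ h.κ x m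
    rw [gaussVecPDF_eq, ngPDF, mul_assoc _ (Real.exp (-((updateGG φ x).β * lam))), ← hexp]
    ring
  simp only [key]
  rw [integral_const_mul, integral_exp_neg_mul_sub_sq]
  have h₁ : π / ((updateGG φ x).κ * lam / 2) = 2 * π / ((updateGG φ x).κ * lam) := by
    field_simp
  have hpow : lam ^ ((updateGG φ x).α - 1) * Real.sqrt lam =
      Real.sqrt lam ^ n * lam ^ (φ.α - 1 / 2) := by
    have hn : Real.sqrt lam ^ n = lam ^ ((n : ℝ) / 2) := by
      rw [Real.sqrt_eq_rpow, ← Real.rpow_natCast, ← Real.rpow_mul hlam.le]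
      congr 1
      ring
    rw [hn, Real.sqrt_eq_rpow, ← Real.rpow_add hlam, ← Real.rpow_add hlam]
    congr 1
    simp only [updateGG]
    ring
  have hs : Real.sqrt lam ≠ 0 := (Real.sqrt_pos.2 hlam).ne'
  have hs' : Real.sqrt (updateGG φ x).κ ≠ 0 := (Real.sqrt_pos.2 hκ).ne'
  have hp : Real.sqrt (2 * π) ≠ 0 := (Real.sqrt_pos.2 (by positivity)).ne'
  have hΓ : Real.Gamma φ.α ≠ 0 := (Real.Gamma_pos_of_pos h.α).ne'
  rw [h₁, Real.sqrt_div hlam.le, Real.sqrt_div (by positivity), Real.sqrt_mul hκ.le, div_pow]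
  generalize Real.sqrt (2 * π) = p at *
  generalize hE : Real.exp (-((updateGG φ x).β * lam)) = E
  trans φ.β ^ φ.α * Real.sqrt φ.κ / (Real.Gamma φ.α * Real.sqrt (updateGG φ x).κ * p ^ n) * E *
      (Real.sqrt lam ^ n * lam ^ (φ.α - 1 / 2)) / Real.sqrt lam
  · field_simp
  · rw [← hpow]
    field_simp

/-- Closed form of the posterior predictive probability. -/
lemma postPred_eq {n : ℕ} {φ : GG} (h : φ.Pos) (x : Fin n → ℝ) :
    postPred φ x = φ.β ^ φ.α * Real.sqrt φ.κ * Real.Gamma (updateGG φ x).α /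
      (Real.Gamma φ.α * Real.sqrt (updateGG φ x).κ * (updateGG φ x).β ^ (updateGG φ x).α *
        Real.sqrt (2 * π) ^ n) := by
  have hu := h.updateGG x
  rw [postPred, setIntegral_congr_fun measurableSet_Ioi
    fun lam hlam => integral_gaussVecPDF_mul_ngPDF h x hlam, integral_const_mul,
    Real.integral_rpow_mul_exp_neg_mul_Ioi hu.α hu.β, Real.div_rpow zero_le_one hu.β.le,
    Real.one_rpow]
  field_simp

lemma postPred_pos {n : ℕ} {φ : GG} (h : φ.Pos) (x : Fin n → ℝ) : 0 < postPred φ x := by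
  have hu := h.updateGG x
  have := Real.Gamma_pos_of_pos h.α
  have := Real.Gamma_pos_of_pos hu.α
  have := Real.sqrt_pos.2 h.κ
  have := Real.sqrt_pos.2 hu.κ
  have := Real.rpow_pos_of_pos h.β φ.α
  have := Real.rpow_pos_of_pos hu.β (updateGG φ x).α
  rw [postPred_eq h]
  positivity

lemma postPred_of_isEmpty {φ : GG} (h : φ.Pos) (x : Fin 0 → ℝ) : postPred φ x = 1 := by
  have := Real.Gamma_pos_of_pos h.α
  have := Real.sqrt_pos.2 h.κ
  have := Real.rpow_pos_of_pos h.β φ.α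
  rw [postPred_eq h, updateGG_of_isEmpty φ x h.κ.ne', pow_zero]
  field_simp

/-- Eqs. (3) and (13): the uncertain likelihood ratio is the product of the uncertain
likelihood updates, and each update admits a closed form. -/
theorem uncertain_likelihood_update_closed_form
    {R : ℕ} (r : Fin R → ℝ) (w : ℕ → ℝ)
    (Λ : ℕ → ℝ)
    (hΛ : ∀ t, Λ t = if t = 0 then 1 else
      postPred (updateGG phi0 r) (fun k : Fin t => w k) /
        postPred phi0 (fun k : Fin t => w k)) :
    (∀ t, 1 ≤ t → Λ t = ∏ τ ∈ Finset.range t, (Λ (τ + 1) / Λ τ)) ∧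
    (∀ t, Λ (t + 1) / Λ t =
      Real.Gamma (phiRT r w (t + 1)).α * Real.Gamma (phiT w t).α *
        (phiT w (t + 1)).β ^ (phiT w (t + 1)).α * (phiRT r w t).β ^ (phiRT r w t).α /
      (Real.Gamma (phiT w (t + 1)).α * Real.Gamma (phiRT r w t).α *
        (phiT w t).β ^ (phiT w t).α * (phiRT r w (t + 1)).β ^ (phiRT r w (t + 1)).α) *
      ((phiT w (t + 1)).κ * (phiRT r w t).κ / ((phiT w t).κ * (phiRT r w (t + 1)).κ))
        ^ ((1 : ℝ) / 2)) := by
  have hr : (updateGG phi0 r).Pos := phi0_pos.updateGG r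
  have hratio : ∀ t, Λ t = postPred (updateGG phi0 r) (fun k : Fin t => w k) /
      postPred phi0 (fun k : Fin t => w k) := by
    intro t
    rw [hΛ]
    split_ifs with ht
    · subst ht
      rw [postPred_of_isEmpty hr, postPred_of_isEmpty phi0_pos, div_one]
    · rfl
  have hpos : ∀ t, 0 < Λ t := fun t => by
    rw [hratio]
    exact div_pos (postPred_pos hr _) (postPred_pos phi0_pos _)
  refine ⟨fun t ht => ?_, fun t => ?_⟩
  · clear ht
    induction t with
    | zero => simp [hΛ]
    | succ t ih => rw [Finset.prod_range_succ, ← ih, mul_div_cancel₀ _ (hpos t).ne']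
  · have hRT : ∀ s, updateGG (updateGG phi0 r) (fun k : Fin s => w k) = phiRT r w s :=
      fun s => (updateGG_append phi0 phi0_pos.κ _ _).symm
    have hT : ∀ s, updateGG phi0 (fun k : Fin s => w k) = phiT w s := fun _ => rfl
    have pRT : ∀ s, (phiRT r w s).Pos := fun _ => phi0_pos.updateGG _
    have pT : ∀ s, (phiT w s).Pos := fun _ => phi0_pos.updateGG _
    rw [hratio, hratio, postPred_eq hr, postPred_eq hr, postPred_eq phi0_pos, postPred_eq phi0_pos,
      hRT, hRT, hT, hT, ← Real.sqrt_eq_rpow,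
      Real.sqrt_div (mul_pos (pT _).κ (pRT _).κ).le, Real.sqrt_mul (pT _).κ.le,
      Real.sqrt_mul (pT _).κ.le]
    have hp : Real.sqrt (2 * π) ≠ 0 := (Real.sqrt_pos.2 (by positivity)).ne'
    have hG : ∀ {φ : GG}, φ.Pos → Real.Gamma φ.α ≠ 0 ∧ Real.sqrt φ.κ ≠ 0 ∧ φ.β ^ φ.α ≠ 0 :=
      fun h => ⟨(Real.Gamma_pos_of_pos h.α).ne', (Real.sqrt_pos.2 h.κ).ne',
        (Real.rpow_pos_of_pos h.β _).ne'⟩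
    obtain ⟨_, _, _⟩ := hG hr
    obtain ⟨_, _, _⟩ := hG phi0_pos
    obtain ⟨_, _, _⟩ := hG (pRT t)
    obtain ⟨_, _, _⟩ := hG (pRT (t + 1))
    obtain ⟨_, _, _⟩ := hG (pT t)
    obtain ⟨_, _, _⟩ := hG (pT (t + 1))
    field_simp

end
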